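/- (a) If a tournament G admits a numbering with local chromatic number at most c, then G contains no diamond with chromatic number more than 2c. (b) Conversely, for every integer c ≥ 0 there exists d ≥ 0 such that if a tournament G contains no diamond with chromatic number more than c, then G admits a numbering with local chromatic number at most d. -/

import Mathlib

structure Tournament where
  V : Type
  fintype : Fintype V
  adj : V → V → Prop
  asymm : ∀ u v, adj u v → ¬ adj v u
  total : ∀ u v, u ≠ v → adj u v ∨ adj v u

attribute [instance] Tournament.fintype

namespace Tournament

/-- A set of vertices is transitive if it includes no cyclic triangle. -/
def IsTransitiveSet (T : Tournament) (A : Set T.V) : Prop :=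
  ∀ a ∈ A, ∀ b ∈ A, ∀ c ∈ A, T.adj a b → T.adj b c → ¬ T.adj c a

/-- The chromatic number of the subtournament induced on `A`. -/
noncomputable def chiOn (T : Tournament) (A : Set T.V) : ℕ :=
  sInf {k | ∃ C : Fin k → Set T.V, (∀ i, T.IsTransitiveSet (C i)) ∧ A ⊆ ⋃ i, C i}

noncomputable def chi (T : Tournament) : ℕ := T.chiOn Set.univ

def outN (T : Tournament) (v : T.V) : Set T.V := {u | T.adj v u}
def inN (T : Tournament) (v : T.V) : Set T.V := {u | T.adj u v}

/-- The domination number of the subtournament induced on `A`. -/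
noncomputable def domOn (T : Tournament) (A : Set T.V) : ℕ :=
  sInf {n | ∃ X : Finset T.V, ↑X ⊆ A ∧ (∀ v ∈ A, v ∉ X → ∃ x ∈ X, T.adj x v) ∧ X.card = n}

noncomputable def dom (T : Tournament) : ℕ := T.domOn Set.univ

/-- `A ⇒ B`: every edge between `A` and `B` is directed from `A` to `B`. -/
def CompleteTo (T : Tournament) (A B : Set T.V) : Prop :=
  ∀ a ∈ A, ∀ b ∈ B, T.adj a b

def CompletePair (T : Tournament) (A B : Set T.V) : Prop :=
  Disjoint A B ∧ T.CompleteTo A B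

/-- `G` has a subtournament inside `A` isomorphic to `H`. -/
def ContainsOn (G : Tournament) (A : Set G.V) (H : Tournament) : Prop :=
  ∃ f : H.V → G.V, Function.Injective f ∧ (∀ u, f u ∈ A) ∧
    ∀ u v, H.adj u v ↔ G.adj (f u) (f v)

def Contains (G H : Tournament) : Prop := G.ContainsOn Set.univ H

def IsHero (H : Tournament) : Prop :=
  ∃ c > 0, ∀ G : Tournament, ¬ G.Contains H → G.chi < c

def IsRebel (H : Tournament) : Prop :=
  ∃ c > 0, ∀ G : Tournament, ¬ G.Contains H → G.dom < c

/-- The set of backward out-neighbours and forward in-neighbours of the `i`-th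
vertex of the numbering `σ`. -/
def localSet (G : Tournament) {n : ℕ} (σ : Fin n ≃ G.V) (i : Fin n) : Set G.V :=
  {v | ∃ j : Fin n, v = σ j ∧
    ((j < i ∧ G.adj (σ i) (σ j)) ∨ (i < j ∧ G.adj (σ j) (σ i)))}

/-- The numbering `σ` has local chromatic number at most `c`. -/
def LocalChiLE (G : Tournament) {n : ℕ} (σ : Fin n ≃ G.V) (c : ℕ) : Prop :=
  ∀ i : Fin n, G.chiOn (G.localSet σ i) ≤ c
/-- A diamond `(a,b,P,Q)`: `a ⇒ P ⇒ b ⇒ Q ⇒ a` with `P, Q` disjoint subsets of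
`V(G) ∖ {a,b}`. Its chromatic number is `min (χ(P)) (χ(Q))`. -/
def IsDiamond (G : Tournament) (a b : G.V) (P Q : Set G.V) : Prop :=
  a ≠ b ∧ a ∉ P ∧ b ∉ P ∧ a ∉ Q ∧ b ∉ Q ∧ Disjoint P Q ∧
    (∀ p ∈ P, G.adj a p) ∧ (∀ p ∈ P, G.adj p b) ∧
    (∀ q ∈ Q, G.adj b q) ∧ (∀ q ∈ Q, G.adj q a)
end Tournament

namespace Tournament

/-- `A` can be coloured with `k` colours. -/
def Col (T : Tournament) (A : Set T.V) (k : ℕ) : Prop :=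
  ∃ f : T.V → ℕ, (∀ v ∈ A, f v < k) ∧ ∀ a ∈ A, ∀ b ∈ A, ∀ c ∈ A,
    f a = f b → f b = f c → T.adj a b → T.adj b c → ¬ T.adj c a

theorem not_adj_self (T : Tournament) (v : T.V) : ¬ T.adj v v := fun h => T.asymm v v h h

theorem adj_of_not (T : Tournament) {u v : T.V} (h : u ≠ v) (h' : ¬ T.adj u v) : T.adj v u :=
  (T.total u v h).resolve_left h'

theorem col_iff_cover (T : Tournament) (A : Set T.V) (k : ℕ) :
    T.Col A k ↔ ∃ C : Fin k → Set T.V, (∀ i, T.IsTransitiveSet (C i)) ∧ A ⊆ ⋃ i, C i := by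
  classical
  constructor
  · rintro ⟨f, hf, hA⟩
    refine ⟨fun i => {v | v ∈ A ∧ f v = i}, ?_, ?_⟩
    · rintro i a ⟨ha, ha'⟩ b ⟨hb, hb'⟩ c ⟨hc, hc'⟩
      exact hA a ha b hb c hc (ha'.trans hb'.symm) (hb'.trans hc'.symm)
    · intro v hv
      exact Set.mem_iUnion.2 ⟨⟨f v, hf v hv⟩, hv, rfl⟩
  · rintro ⟨C, hC, hA⟩
    have h : ∀ v, v ∈ A → ∃ i, v ∈ C i := fun v hv => Set.mem_iUnion.1 (hA hv)
    choose g hg using h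
    refine ⟨fun v => if hv : v ∈ A then (g v hv : ℕ) else 0, ?_, ?_⟩
    · intro v hv
      simp [hv]
    · intro a ha b hb c hc hab hbc
      simp only [ha, hb, hc, dif_pos] at hab hbc
      have h1 := Fin.ext hab
      have h2 := Fin.ext hbc
      have hga := hg a ha
      have hgb := hg b hb
      have hgc := hg c hc
      rw [← h2] at hgc
      rw [h1] at hga
      exact hC _ a hga b hgb c hgc

theorem Col.mono {T : Tournament} {A B : Set T.V} {k m : ℕ} (h : T.Col B k) (hAB : A ⊆ B)
    (hk : k ≤ m) : T.Col A m := by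
  obtain ⟨f, hf, hB⟩ := h
  exact ⟨f, fun v hv => (hf v (hAB hv)).trans_le hk, fun a ha b hb c hc =>
    hB a (hAB ha) b (hAB hb) c (hAB hc)⟩

theorem exists_col (T : Tournament) (A : Set T.V) : ∃ k, T.Col A k := by
  let e := Fintype.equivFin T.V
  refine ⟨Fintype.card T.V, fun v => (e v : ℕ), fun v _ => (e v).2, ?_⟩
  intro a _ b _ c _ hab _ h
  have : a = b := e.injective (Fin.ext hab)
  subst this
  exact absurd h (T.not_adj_self a)

theorem chiOn_le_iff (T : Tournament) (A : Set T.V) (k : ℕ) : T.chiOn A ≤ k ↔ T.Col A k := by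
  have hne : {k | ∃ C : Fin k → Set T.V, (∀ i, T.IsTransitiveSet (C i)) ∧ A ⊆ ⋃ i, C i}.Nonempty := by
    obtain ⟨m, hm⟩ := T.exists_col A
    exact ⟨m, (T.col_iff_cover A m).1 hm⟩
  constructor
  · intro h
    exact ((T.col_iff_cover A _).2 (Nat.sInf_mem hne)).mono subset_rfl h
  · intro h
    exact Nat.sInf_le ((T.col_iff_cover A k).1 h)

theorem Col.union {T : Tournament} {A B : Set T.V} {k m : ℕ} (hA : T.Col A k) (hB : T.Col B m) :
    T.Col (A ∪ B) (k + m) := by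
  classical
  obtain ⟨f, hf, hA⟩ := hA
  obtain ⟨g, hg, hB⟩ := hB
  refine ⟨fun v => if v ∈ A then f v else k + g v, ?_, ?_⟩
  · intro v hv
    by_cases h : v ∈ A
    · have := hf v h
      simp only [h, if_true]; omega
    · have := hg v (hv.resolve_left h)
      simp only [h, if_false]; omega
  · intro a ha b hb c hc hab hbc
    have fa := hf a
    have fb := hf b
    have fc := hf c
    by_cases h1 : a ∈ A <;> by_cases h2 : b ∈ A <;> by_cases h3 : c ∈ A <;>
      simp only [h1, h2, h3, if_true, if_false, forall_const] at hab hbc fa fb fc <;> try omega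
    · exact hA a h1 b h2 c h3 hab hbc
    · exact hB a (ha.resolve_left h1) b (hb.resolve_left h2) c (hc.resolve_left h3)
        (by omega) (by omega)

theorem col_singleton (T : Tournament) (v : T.V) : T.Col {v} 1 := by
  refine ⟨fun _ => 0, fun _ _ => Nat.zero_lt_one, ?_⟩
  rintro a rfl b rfl c rfl _ _ h
  exact absurd h (T.not_adj_self _)

theorem col_empty (T : Tournament) (k : ℕ) : T.Col ∅ k :=
  ⟨fun _ => 0, fun _ h => h.elim, fun _ h => h.elim⟩

theorem col_biUnion (T : Tournament) (X : Finset T.V) (F : T.V → Set T.V) (m : ℕ)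
    (h : ∀ x ∈ X, T.Col (F x) m) : T.Col (⋃ x ∈ X, F x) (X.card * m) := by
  classical
  induction X using Finset.induction_on with
  | empty => simpa using T.col_empty _
  | insert a X ha ih =>
    rw [Finset.card_insert_of_notMem ha, Finset.set_biUnion_insert, Nat.succ_mul, add_comm]
    exact (h a (by simp)).union (ih fun x hx => h x (by simp [hx]))

/-- If `A` is not `(k-1)`-colourable, every colouring with `k` colours uses every colour. -/
theorem uses_color (T : Tournament) (A : Set T.V) (k : ℕ) (hA : ∀ m < k, ¬ T.Col A m)
    (f : T.V → ℕ) (hf : ∀ v ∈ A, f v < k)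
    (hf' : ∀ a ∈ A, ∀ b ∈ A, ∀ c ∈ A,
      f a = f b → f b = f c → T.adj a b → T.adj b c → ¬ T.adj c a)
    (i : ℕ) (hi : i < k) : ∃ v ∈ A, f v = i := by
  by_contra hcon
  push Not at hcon
  refine hA (k - 1) (by omega) ⟨fun v => if f v = k - 1 then i else f v, ?_, ?_⟩
  · intro v hv
    have h1 := hf v hv
    have h2 := hcon v hv
    dsimp only
    split_ifs <;> omega
  · intro a ha b hb c hc hab hbc
    have h1 := hcon a ha
    have h2 := hcon b hb
    have h3 := hcon c hc
    dsimp only at hab hbc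
    refine hf' a ha b hb c hc ?_ ?_
    · split_ifs at hab <;> omega
    · split_ifs at hbc <;> omega

/-- `X` dominates `S`. -/
def Dominates (T : Tournament) (X : Finset T.V) (S : Set T.V) : Prop :=
  ∀ v ∈ S, v ∈ X ∨ ∃ x ∈ X, T.adj x v

/-- Large domination number forces a bounded-size subset of large chromatic number. -/
theorem large_dom (k : ℕ) : ∃ K l : ℕ, ∀ (T : Tournament) (S : Set T.V),
    (∀ X : Finset T.V, ↑X ⊆ S → X.card ≤ K → ¬ T.Dominates X S) →
    ∃ A : Finset T.V, ↑A ⊆ S ∧ A.card ≤ l ∧ ∀ m < k, ¬ T.Col (A : Set T.V) m := by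
  classical
  induction k with
  | zero => exact ⟨0, 0, fun T S _ => ⟨∅, by simp, by simp, by simp⟩⟩
  | succ k ih =>
    obtain ⟨K, l, ih⟩ := ih
    set s := K + l + 1 with hs
    set N := k * s + 1 with hN
    refine ⟨N + K, N + l + 2 ^ N * l, fun T S hS => ?_⟩
    -- a minimum dominating set
    have hex : ∃ n, ∃ D : Finset T.V, ↑D ⊆ S ∧ T.Dominates D S ∧ D.card = n := by
      refine ⟨_, S.toFinite.toFinset, by simp, ?_, rfl⟩
      intro v hv
      exact Or.inl (by simpa using hv)
    obtain ⟨D, hDS, hD, hDc⟩ := Nat.find_spec hex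
    have hmin : ∀ D' : Finset T.V, ↑D' ⊆ S → T.Dominates D' S → D.card ≤ D'.card := by
      intro D' h1 h2
      rw [hDc]
      exact Nat.find_min' hex ⟨D', h1, h2, rfl⟩
    have hDbig : N + K < D.card := by
      by_contra h
      exact hS D hDS (by omega) hD
    obtain ⟨W, hWD, hWc⟩ := Finset.exists_subset_card_eq (show N ≤ D.card by omega)
    have hWS : (W : Set T.V) ⊆ S := fun x hx => hDS (hWD hx)
    obtain ⟨A, hAS, hAc, hA⟩ := ih T {v | v ∈ S ∧ ∀ w ∈ W, v ≠ w ∧ ¬ T.adj w v} (by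
      intro X hX hXc hdom
      refine hS (W ∪ X) ?_ ((Finset.card_union_le _ _).trans (by omega)) ?_
      · intro x hx
        rcases Finset.mem_union.1 (Finset.mem_coe.1 hx) with h | h
        · exact hWS h
        · exact (hX h).1
      · intro v hv
        by_cases h : ∀ w ∈ W, v ≠ w ∧ ¬ T.adj w v
        · rcases hdom v ⟨hv, h⟩ with h | ⟨x, hx, hxv⟩
          · exact Or.inl (by simp [h])
          · exact Or.inr ⟨x, by simp [hx], hxv⟩
        · push Not at h
          obtain ⟨w, hw, hwv⟩ := h
          by_cases hvw : v = w
          · exact Or.inl (by simp [hvw, hw])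
          · exact Or.inr ⟨w, by simp [hw], hwv hvw⟩)
    have hAW : ∀ a ∈ A, ∀ w ∈ W, T.adj a w := by
      intro a ha w hw
      have h := (hAS (Finset.mem_coe.2 ha)).2 w hw
      exact T.adj_of_not (Ne.symm h.1) h.2
    have key : ∀ R : Finset T.V, R ⊆ W ∧ s ≤ R.card → ∃ B : Finset T.V,
        (B : Set T.V) ⊆ {v | v ∈ S ∧ ∀ w ∈ A ∪ (D \ R), v ≠ w ∧ ¬ T.adj w v} ∧
        B.card ≤ l ∧ ∀ m < k, ¬ T.Col (B : Set T.V) m := by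
      rintro R ⟨hRW, hRc⟩
      apply ih T
      intro X hX hXc hdom
      have hRD : R ⊆ D := hRW.trans hWD
      have hle := hmin ((A ∪ (D \ R)) ∪ X) (by
        intro x hx
        rcases Finset.mem_union.1 (Finset.mem_coe.1 hx) with h | h
        · rcases Finset.mem_union.1 h with h | h
          · exact (hAS h).1
          · exact hDS (Finset.mem_sdiff.1 h).1
        · exact (hX h).1) (by
        intro v hv
        by_cases h : ∀ w ∈ A ∪ (D \ R), v ≠ w ∧ ¬ T.adj w v
        · rcases hdom v ⟨hv, h⟩ with h | ⟨x, hx, hxv⟩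
          · exact Or.inl (Finset.mem_union_right _ h)
          · exact Or.inr ⟨x, Finset.mem_union_right _ hx, hxv⟩
        · push Not at h
          obtain ⟨w, hw, hwv⟩ := h
          by_cases hvw : v = w
          · exact Or.inl (Finset.mem_union_left _ (hvw ▸ hw))
          · exact Or.inr ⟨w, Finset.mem_union_left _ hw, hwv hvw⟩)
      have c1 := Finset.card_union_le (A ∪ (D \ R)) X
      have c2 := Finset.card_union_le A (D \ R)
      have c3 := Finset.card_sdiff_of_subset hRD
      have c4 := Finset.card_le_card hRD
      omega
    choose! B hBS hBc hB using key
    set Z := (W.powerset.filter fun R => s ≤ R.card) with hZ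
    have hZmem : ∀ R, R ∈ Z ↔ R ⊆ W ∧ s ≤ R.card := by
      intro R; simp [hZ]
    refine ⟨W ∪ A ∪ Z.biUnion B, ?_, ?_, ?_⟩
    · intro x hx
      rcases Finset.mem_union.1 (Finset.mem_coe.1 hx) with h | h
      · rcases Finset.mem_union.1 h with h | h
        · exact hWS h
        · exact (hAS h).1
      · obtain ⟨R, hR, hxR⟩ := Finset.mem_biUnion.1 h
        exact (hBS R ((hZmem R).1 hR) hxR).1
    · have c1 := Finset.card_union_le (W ∪ A) (Z.biUnion B)
      have c2 := Finset.card_union_le W A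
      have c3 : (Z.biUnion B).card ≤ Z.card * l :=
        Finset.card_biUnion_le_card_mul _ _ _ fun R hR => hBc R ((hZmem R).1 hR)
      have c4 : Z.card ≤ 2 ^ N := by
        refine (Finset.card_filter_le _ _).trans ?_
        rw [Finset.card_powerset, hWc]
      have c5 := Nat.mul_le_mul_right l c4
      omega
    · intro m hm hcol
      obtain ⟨f, hf, htr⟩ := hcol.mono subset_rfl (show m ≤ k by omega)
      have hmW : ∀ w ∈ W, w ∈ ((W ∪ A ∪ Z.biUnion B : Finset T.V) : Set T.V) := by
        intro w hw
        exact Finset.mem_coe.2 (Finset.mem_union_left _ (Finset.mem_union_left _ hw))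
      have hmA : ∀ w ∈ A, w ∈ ((W ∪ A ∪ Z.biUnion B : Finset T.V) : Set T.V) := by
        intro w hw
        exact Finset.mem_coe.2 (Finset.mem_union_left _ (Finset.mem_union_right _ hw))
      obtain ⟨i, hi, hic⟩ := Finset.exists_lt_card_fiber_of_mul_lt_card_of_maps_to
        (s := W) (t := Finset.range k) (f := f) (n := s)
        (fun w hw => Finset.mem_range.2 (hf w (hmW w hw)))
        (by rw [Finset.card_range]; omega)
      have hi := Finset.mem_range.1 hi
      set R := W.filter (fun w => f w = i) with hRdef
      have hR : R ⊆ W ∧ s ≤ R.card := ⟨Finset.filter_subset _ _, hic.le⟩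
      have hmB : ∀ w ∈ B R, w ∈ ((W ∪ A ∪ Z.biUnion B : Finset T.V) : Set T.V) := by
        intro w hw
        exact Finset.mem_coe.2 (Finset.mem_union_right _
          (Finset.mem_biUnion.2 ⟨R, (hZmem R).2 hR, hw⟩))
      obtain ⟨a, ha, hai⟩ := T.uses_color A k hA f (fun v hv => hf v (hmA v hv))
        (fun a ha b hb c hc => htr a (hmA a ha) b (hmA b hb) c (hmA c hc)) i hi
      obtain ⟨x, hx, hxi⟩ := T.uses_color (B R) k (hB R hR) f (fun v hv => hf v (hmB v hv))
        (fun a ha b hb c hc => htr a (hmB a ha) b (hmB b hb) c (hmB c hc)) i hi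
      obtain ⟨hxS, hxn⟩ := hBS R hR hx
      have hxa := hxn a (Finset.mem_union_left _ ha)
      have hxa' : T.adj x a := T.adj_of_not (Ne.symm hxa.1) hxa.2
      rcases hD x hxS with hxD | ⟨t, ht, htx⟩
      · by_cases hxR : x ∈ R
        · exact hxa.2 (hAW a ha x (hR.1 hxR))
        · exact (hxn x (Finset.mem_union_right _ (Finset.mem_sdiff.2 ⟨hxD, hxR⟩))).1 rfl
      · by_cases htR : t ∈ R
        · have hti := (Finset.mem_filter.1 htR).2
          exact htr a (hmA a ha) t (hmW t (hR.1 htR)) x (hmB x hx) (hai.trans hti.symm)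
            (hti.trans hxi.symm) (hAW a ha t (hR.1 htR)) htx hxa'
        · exact (hxn t (Finset.mem_union_right _ (Finset.mem_sdiff.2 ⟨ht, htR⟩))).2 htx

/-- From local to global colouring, out-neighbourhood version. -/
theorem local_global_out (k : ℕ) : ∃ d : ℕ, ∀ (T : Tournament) (S : Set T.V),
    (∀ v ∈ S, T.Col {u | u ∈ S ∧ T.adj v u} k) → T.Col S d := by
  classical
  obtain ⟨K, l, h⟩ := large_dom (k + 1)
  refine ⟨(K + l) * (1 + k), fun T S hS => ?_⟩
  by_cases hd : ∃ X : Finset T.V, ↑X ⊆ S ∧ X.card ≤ K + l ∧ T.Dominates X S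
  · obtain ⟨X, hXS, hXc, hX⟩ := hd
    have := T.col_biUnion X (fun x => {x} ∪ {u | u ∈ S ∧ T.adj x u}) (1 + k)
      (fun x hx => (T.col_singleton x).union (hS x (hXS hx)))
    refine this.mono ?_ (Nat.mul_le_mul_right _ hXc)
    intro v hv
    rcases hX v hv with h | ⟨x, hx, hxv⟩
    · exact Set.mem_biUnion (x := v) h (Or.inl rfl)
    · exact Set.mem_biUnion (x := x) hx (Or.inr ⟨hv, hxv⟩)
  · exfalso
    push Not at hd
    obtain ⟨A, hAS, hAc, hA⟩ := h T S fun X h1 h2 => hd X h1 (by omega)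
    have := hd A hAS (by omega)
    unfold Dominates at this
    push Not at this
    obtain ⟨v, hv, hvA, hvn⟩ := this
    refine hA k (by omega) ((hS v hv).mono ?_ le_rfl)
    intro a ha
    exact ⟨hAS ha, T.adj_of_not (fun e => hvA (e ▸ ha)) (hvn a ha)⟩

/-- The reversed tournament. -/
def rev (T : Tournament) : Tournament where
  V := T.V
  fintype := T.fintype
  adj u v := T.adj v u
  asymm u v h := T.asymm v u h
  total u v h := (T.total u v h).symm

theorem col_rev (T : Tournament) (A : Set T.V) (k : ℕ) (h : T.Col A k) : T.rev.Col A k := by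
  obtain ⟨f, hf, h⟩ := h
  exact ⟨f, hf, fun a ha b hb c hc hab hbc h1 h2 h3 =>
    h c hc b hb a ha hbc.symm hab.symm h2 h1 h3⟩

theorem local_global_in (k : ℕ) : ∃ d : ℕ, ∀ (T : Tournament) (S : Set T.V),
    (∀ v ∈ S, T.Col {u | u ∈ S ∧ T.adj u v} k) → T.Col S d := by
  obtain ⟨d, h⟩ := local_global_out k
  exact ⟨d, fun T S hS => T.rev.col_rev S d (h T.rev S fun v hv => T.col_rev _ k (hS v hv))⟩

/-- Kings for a total relation. -/
theorem exists_king {V : Type} (R : V → V → Prop) (hR : ∀ u v, R u v ∨ R v u) (s : Finset V)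
    (hs : s.Nonempty) : ∃ u ∈ s, ∀ v ∈ s, ∃ w ∈ s, R u w ∧ R w v := by
  classical
  have hrefl : ∀ u, R u u := fun u => (hR u u).elim id id
  induction hs using Finset.Nonempty.cons_induction with
  | singleton a => exact ⟨a, by simp, by simp [hrefl]⟩
  | cons x s hx hs ih =>
    obtain ⟨u, hu, hk⟩ := ih
    by_cases h : ∃ w ∈ s, R u w ∧ R w x
    · refine ⟨u, by simp [hu], ?_⟩
      intro v hv
      rcases Finset.mem_cons.1 hv with rfl | hv
      · obtain ⟨w, hw, h⟩ := h
        exact ⟨w, by simp [hw], h⟩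
      · obtain ⟨w, hw, h⟩ := hk v hv
        exact ⟨w, by simp [hw], h⟩
    · push Not at h
      refine ⟨x, by simp, ?_⟩
      intro v hv
      rcases Finset.mem_cons.1 hv with rfl | hv
      · exact ⟨v, by simp, hrefl v, hrefl v⟩
      · obtain ⟨w, hw, h1, h2⟩ := hk v hv
        exact ⟨w, by simp [hw], (hR x w).resolve_right (h w hw h1), h2⟩

theorem exists_king_order {V : Type} (R : V → V → Prop) (hR : ∀ u v, R u v ∨ R v u)
    (n : ℕ) : ∀ s : Finset V, s.card = n → ∃ L : List V, L.Nodup ∧ (∀ x, x ∈ L ↔ x ∈ s) ∧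
      L.Pairwise (fun u v => ∃ w, R u w ∧ R w v) := by
  classical
  induction n with
  | zero =>
    intro s hs
    rw [Finset.card_eq_zero] at hs
    subst hs
    exact ⟨[], by simp⟩
  | succ n ih =>
    intro s hs
    obtain ⟨u, hu, hk⟩ := exists_king R hR s (Finset.card_pos.1 (by omega))
    obtain ⟨L, h1, h2, h3⟩ := ih (s.erase u) (by rw [Finset.card_erase_of_mem hu]; omega)
    refine ⟨u :: L, ?_, ?_, ?_⟩
    · rw [List.nodup_cons]
      exact ⟨by simp [h2], h1⟩
    · intro x
      rw [List.mem_cons, h2, Finset.mem_erase]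
      by_cases hx : x = u <;> simp [hx, hu]
    · rw [List.pairwise_cons]
      refine ⟨fun v hv => ?_, h3⟩
      obtain ⟨w, _, h⟩ := hk v (Finset.mem_of_mem_erase ((h2 v).1 hv))
      exact ⟨w, h⟩

theorem exists_king_numbering {V : Type} [Fintype V] (R : V → V → Prop)
    (hR : ∀ u v, R u v ∨ R v u) :
    ∃ σ : Fin (Fintype.card V) ≃ V, ∀ i j, i < j → ∃ w, R (σ i) w ∧ R w (σ j) := by
  classical
  obtain ⟨L, h1, h2, h3⟩ := exists_king_order R hR _ (Finset.univ : Finset V) rfl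
  have h2' : ∀ x, x ∈ L := fun x => (h2 x).2 (Finset.mem_univ x)
  have hlen : Fintype.card V = L.length := by
    have := Fintype.card_congr (h1.getEquivOfForallMemList L h2')
    simpa using this.symm
  refine ⟨(finCongr hlen).trans (h1.getEquivOfForallMemList L h2'), fun i j hij => ?_⟩
  exact List.pairwise_iff_get.1 h3 (finCongr hlen i) (finCongr hlen j) hij

theorem part_a (G : Tournament) (c n : ℕ) (σ : Fin n ≃ G.V) (h : G.LocalChiLE σ c)
    (a b : G.V) (Q : Set G.V) (hab : σ.symm a < σ.symm b)
    (h1 : ∀ q ∈ Q, G.adj b q) (h2 : ∀ q ∈ Q, G.adj q a) : G.chiOn Q ≤ 2 * c := by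
  rw [chiOn_le_iff]
  have ha := (G.chiOn_le_iff _ _).1 (h (σ.symm a))
  have hb := (G.chiOn_le_iff _ _).1 (h (σ.symm b))
  refine (ha.union hb).mono ?_ (by omega)
  intro q hq
  rcases lt_or_ge (σ.symm a) (σ.symm q) with hlt | hge
  · left
    exact ⟨σ.symm q, by simp, Or.inr ⟨hlt, by simpa using h2 q hq⟩⟩
  · right
    exact ⟨σ.symm q, by simp, Or.inl ⟨hge.trans_lt hab, by simpa using h1 q hq⟩⟩

end Tournament

open Tournament in
/-- (a) A numbering with local chromatic number at most `c` forbids diamonds of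
chromatic number more than `2c`; (b) conversely, if all diamonds have chromatic
number at most `c` then some numbering has local chromatic number at most `d`,
where `d` depends only on `c`. -/
theorem diamonds_and_numberings :
    (∀ (G : Tournament) (c : ℕ) (σ : Fin (Fintype.card G.V) ≃ G.V),
        G.LocalChiLE σ c →
        ∀ a b P Q, G.IsDiamond a b P Q →
          min (G.chiOn P) (G.chiOn Q) ≤ 2 * c) ∧
      (∀ c : ℕ, ∃ d : ℕ, ∀ G : Tournament,
        (∀ a b P Q, G.IsDiamond a b P Q →
          min (G.chiOn P) (G.chiOn Q) ≤ c) →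
        ∃ σ : Fin (Fintype.card G.V) ≃ G.V, G.LocalChiLE σ d) := by
  constructor
  · rintro G c σ h a b P Q ⟨hne, -, -, -, -, -, h1, h2, h3, h4⟩
    rcases lt_trichotomy (σ.symm a) (σ.symm b) with hab | hab | hab
    · exact (min_le_right _ _).trans (part_a G c _ σ h a b Q hab h3 h4)
    · exact absurd (σ.symm.injective hab) hne
    · exact (min_le_left _ _).trans (part_a G c _ σ h b a P hab h1 h2)
  · intro c
    obtain ⟨d₁, hd₁⟩ := local_global_in (c + (c + 1))
    obtain ⟨d₂, hd₂⟩ := local_global_out (c + (c + 1))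
    refine ⟨d₁ + d₂, fun G hG => ?_⟩
    obtain ⟨σ, hσ⟩ := exists_king_numbering
      (fun u v : G.V => G.Col {x | G.adj v x ∧ G.adj x u} c) (by
        intro u v
        by_cases huv : u = v
        · subst huv
          left
          exact (G.col_empty c).mono (fun x hx => (G.asymm _ _ hx.1 hx.2).elim) le_rfl
        · have := hG v u {x | G.adj v x ∧ G.adj x u} {x | G.adj u x ∧ G.adj x v}
            ⟨Ne.symm huv, fun h => G.not_adj_self _ h.1, fun h => G.not_adj_self _ h.2,
              fun h => G.not_adj_self _ h.2, fun h => G.not_adj_self _ h.1,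
              Set.disjoint_left.2 fun x h1 h2 => G.asymm _ _ h1.1 h2.2,
              fun p h => h.1, fun p h => h.2, fun p h => h.1, fun p h => h.2⟩
          rw [min_le_iff, chiOn_le_iff, chiOn_le_iff] at this
          exact this)
    have key : ∀ i j, i < j →
        G.Col {x | G.adj (σ j) x ∧ G.adj x (σ i)} (c + (c + 1)) := by
      intro i j hij
      obtain ⟨w, h1, h2⟩ := hσ i j hij
      refine (h1.union (h2.union (G.col_singleton w))).mono ?_ le_rfl
      rintro x ⟨hx1, hx2⟩
      by_cases hxw : x = w
      · exact Or.inr (Or.inr hxw)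
      · rcases G.total x w hxw with h | h
        · exact Or.inr (Or.inl ⟨hx1, h⟩)
        · exact Or.inl ⟨h, hx2⟩
    refine ⟨σ, fun i => ?_⟩
    rw [chiOn_le_iff]
    have hB := hd₁ G {v | ∃ j, v = σ j ∧ j < i ∧ G.adj (σ i) (σ j)} (by
      rintro v ⟨j, rfl, hji, hadj⟩
      refine (key j i hji).mono ?_ le_rfl
      rintro u ⟨⟨m, rfl, hmi, hm⟩, hu⟩
      exact ⟨hm, hu⟩)
    have hF := hd₂ G {v | ∃ j, v = σ j ∧ i < j ∧ G.adj (σ j) (σ i)} (by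
      rintro v ⟨j, rfl, hji, hadj⟩
      refine (key i j hji).mono ?_ le_rfl
      rintro u ⟨⟨m, rfl, hmi, hm⟩, hu⟩
      exact ⟨hu, hm⟩)
    refine (hB.union hF).mono ?_ le_rfl
    rintro v ⟨j, hv, h | h⟩
    · exact Or.inl ⟨j, hv, h⟩
    · exact Or.inr ⟨j, hv, h⟩
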